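/- For all λσ-terms t, t', u and substitutions s, s' in σ-normal form: if σ(t[1·(s∘↑)]) = σ(t'[1·(s'∘↑)]) then σ(t[u·s]) = σ(t'[u·s']). -/

import Mathlib

namespace LambdaSigma

/-- Simple types. -/
inductive Ty : Type
  | base : Ty
  | arrow : Ty → Ty → Ty

mutual
/-- Terms of the λσ-calculus: `one` is the index 1, plus application,
abstraction and closure `t[s]`. -/
inductive Tm : Type
  | one : Tm
  | app : Tm → Tm → Tm
  | lam : Tm → Tm
  | sub : Tm → Sb → Tm

/-- Substitutions of λσ: `id`, `↑`, `t·s` and `s∘s'`. -/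
inductive Sb : Type
  | id : Sb
  | shift : Sb
  | cons : Tm → Sb → Sb
  | comp : Sb → Sb → Sb
end

/-- The de Bruijn index `k+1`, following the convention `n+1 = n[↑]`:
`idx k` is the term representing the index `k+1`. -/
def idx : ℕ → Tm
  | 0 => .one
  | k + 1 => .sub (idx k) .shift

/-- Recognize the terms which are de Bruijn indices: `toIdx? t = some k`
iff `t = idx k` (i.e. `t` is the index `k+1`). -/
def toIdx? : Tm → Option ℕ
  | .one => some 0
  | .sub t .shift => (toIdx? t).map (· + 1)
  | _ => none

mutual
/-- The re-indexing function `⇑ᵢʲ` on terms (indices being treated as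
atomic constants): `⇑ᵢʲ(n) = n+j` if `n > i`, `n` otherwise, homomorphic on
applications, `⇑ᵢʲ(λt) = λ⇑_{i+1}ʲ(t)`, and `⇑ᵢʲ(t[s]) = ⇑_{i'}ʲ(t)[s']`
where `(i',s') = ⇑ᵢʲ(s)`. -/
def upT (i j : ℕ) : Tm → Tm
  | .one => if 0 < i then .one else idx j
  | .app t u => .app (upT i j t) (upT i j u)
  | .lam t => .lam (upT (i + 1) j t)
  | .sub t s =>
      match toIdx? (.sub t s) with
      | some k => if i ≤ k then idx (k + j) else idx k
      | none =>
          let p := upS i j s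
          .sub (upT p.1 j t) p.2

/-- The re-indexing function `⇑ᵢʲ` on substitutions, returning a pair of an
integer and a substitution. -/
def upS (i j : ℕ) : Sb → ℕ × Sb
  | .id => (i, .id)
  | .shift => (i, .shift)
  | .cons t s =>
      let p := upS i j s
      (p.1 + 1, .cons (upT i j t) p.2)
  | .comp s1 s2 =>
      let p2 := upS i j s2
      let p1 := upS p2.1 j s1
      (p1.1, .comp p1.2 p2.2)
end

/-- Substitution-free terms (de Bruijn indices being treated as atomic
constants containing no substitutions). -/
inductive Pure : Tm → Prop
  | idx (n : ℕ) : Pure (idx n)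
  | app {t u : Tm} : Pure t → Pure u → Pure (.app t u)
  | lam {t : Tm} : Pure t → Pure (.lam t)

mutual
/-- The simple typing system of λσ: `TypT Γ t A` is `Γ ⊢ t : A`. -/
inductive TypT : List Ty → Tm → Ty → Prop
  | one {Γ : List Ty} {A : Ty} : TypT (A :: Γ) .one A
  | app {Γ : List Ty} {t u : Tm} {A B : Ty} :
      TypT Γ t (.arrow B A) → TypT Γ u B → TypT Γ (.app t u) A
  | lam {Γ : List Ty} {t : Tm} {A B : Ty} :
      TypT (B :: Γ) t A → TypT Γ (.lam t) (.arrow B A)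
  | sub {Γ Γ' : List Ty} {t : Tm} {s : Sb} {A : Ty} :
      TypS Γ s Γ' → TypT Γ' t A → TypT Γ (.sub t s) A

/-- Typing of substitutions: `TypS Γ s Γ'` is `Γ ⊢ s ▷ Γ'`. -/
inductive TypS : List Ty → Sb → List Ty → Prop
  | id {Γ : List Ty} : TypS Γ .id Γ
  | shift {Γ : List Ty} {A : Ty} : TypS (A :: Γ) .shift Γ
  | cons {Γ Γ' : List Ty} {t : Tm} {s : Sb} {A : Ty} :
      TypT Γ t A → TypS Γ s Γ' → TypS Γ (.cons t s) (A :: Γ')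
  | comp {Γ Γ' Γ'' : List Ty} {s s' : Sb} :
      TypS Γ s' Γ'' → TypS Γ'' s Γ' → TypS Γ (.comp s s') Γ'
end

-- Sizes used to define `Ateb` by well-founded recursion.
mutual
def szT : Tm → ℕ
  | .one => 1
  | .app t u => szT t + szT u + 1
  | .lam t => szT t + 1
  | .sub t s => szT t + szS s + 1
def szS : Sb → ℕ
  | .id => 1
  | .shift => 1
  | .cons t s => szT t + szS s + 1
  | .comp s s' => szS s + szS s' + 2
end

theorem szT_pos : ∀ t : Tm, 0 < szT t := by
  intro t; cases t <;> simp [szT]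

/-- The expansion `Ateb` from λσ-terms to substitution-free terms. -/
def Ateb : Tm → Tm
  | .one => .one
  | .app t u => .app (Ateb t) (Ateb u)
  | .lam t => .lam (Ateb t)
  | .sub t .id => Ateb t
  | .sub t .shift => upT 0 1 (Ateb t)
  | .sub t (.comp s s') => Ateb (.sub (.sub t s) s')
  | .sub t (.cons t' s) => .app (Ateb (.sub (.lam t) s)) (Ateb t')
termination_by t => szT t
decreasing_by
  all_goals simp [szT, szS]
  all_goals first
    | omega
    | (have := szT_pos t'; omega)

mutual
/-- The σ-rules of λσ on terms (all the rules except `B`), closed under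
arbitrary contexts. -/
inductive SStep : Tm → Tm → Prop
  | app_s {t u : Tm} {s : Sb} :
      SStep (.sub (.app t u) s) (.app (.sub t s) (.sub u s))
  | lam_s {t : Tm} {s : Sb} :
      SStep (.sub (.lam t) s) (.lam (.sub t (.cons .one (.comp s .shift))))
  | varid : SStep (.sub .one .id) .one
  | varcons {t : Tm} {s : Sb} : SStep (.sub .one (.cons t s)) t
  | clos {t : Tm} {s s' : Sb} : SStep (.sub (.sub t s) s') (.sub t (.comp s s'))
  | appl {t t' u : Tm} : SStep t t' → SStep (.app t u) (.app t' u)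
  | appr {t u u' : Tm} : SStep u u' → SStep (.app t u) (.app t u')
  | lam {t t' : Tm} : SStep t t' → SStep (.lam t) (.lam t')
  | subt {t t' : Tm} {s : Sb} : SStep t t' → SStep (.sub t s) (.sub t' s)
  | subs {t : Tm} {s s' : Sb} : SStepS s s' → SStep (.sub t s) (.sub t s')

/-- The σ-rules on substitutions. -/
inductive SStepS : Sb → Sb → Prop
  | idl {s : Sb} : SStepS (.comp .id s) s
  | shiftid : SStepS (.comp .shift .id) .shift
  | shiftcons {t : Tm} {s : Sb} : SStepS (.comp .shift (.cons t s)) s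
  | mapr {t : Tm} {s s' : Sb} :
      SStepS (.comp (.cons t s) s') (.cons (.sub t s') (.comp s s'))
  | assoc {s1 s2 s3 : Sb} :
      SStepS (.comp (.comp s1 s2) s3) (.comp s1 (.comp s2 s3))
  | consl {t t' : Tm} {s : Sb} : SStep t t' → SStepS (.cons t s) (.cons t' s)
  | consr {t : Tm} {s s' : Sb} : SStepS s s' → SStepS (.cons t s) (.cons t s')
  | compl {s1 s1' s2 : Sb} : SStepS s1 s1' → SStepS (.comp s1 s2) (.comp s1' s2)
  | compr {s1 s2 s2' : Sb} : SStepS s2 s2' → SStepS (.comp s1 s2) (.comp s1 s2')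
end

mutual
/-- The rule `B` of λσ, closed under arbitrary contexts. -/
inductive BStep : Tm → Tm → Prop
  | beta {t u : Tm} : BStep (.app (.lam t) u) (.sub t (.cons u .id))
  | appl {t t' u : Tm} : BStep t t' → BStep (.app t u) (.app t' u)
  | appr {t u u' : Tm} : BStep u u' → BStep (.app t u) (.app t u')
  | lam {t t' : Tm} : BStep t t' → BStep (.lam t) (.lam t')
  | subt {t t' : Tm} {s : Sb} : BStep t t' → BStep (.sub t s) (.sub t' s)
  | subs {t : Tm} {s s' : Sb} : BStepS s s' → BStep (.sub t s) (.sub t s')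

/-- The rule `B` inside substitutions. -/
inductive BStepS : Sb → Sb → Prop
  | consl {t t' : Tm} {s : Sb} : BStep t t' → BStepS (.cons t s) (.cons t' s)
  | consr {t : Tm} {s s' : Sb} : BStepS s s' → BStepS (.cons t s) (.cons t s')
  | compl {s1 s1' s2 : Sb} : BStepS s1 s1' → BStepS (.comp s1 s2) (.comp s1' s2)
  | compr {s1 s2 s2' : Sb} : BStepS s2 s2' → BStepS (.comp s1 s2) (.comp s1 s2')
end

/-- The full λσ-reduction on terms: the union of `B` and the σ-rules. -/
def Step (t u : Tm) : Prop := BStep t u ∨ SStep t u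

/-- A term is in σ-normal form. -/
def SNormT (t : Tm) : Prop := ∀ u : Tm, ¬ SStep t u

/-- A substitution is in σ-normal form. -/
def SNormS (s : Sb) : Prop := ∀ s' : Sb, ¬ SStepS s s'

/-- `σ(t) = σ(u)` : the terms `t` and `u` have the same σ-normal form
(the σ-calculus being strongly normalizing and confluent, this is expressed
by the existence of a common σ-reduct in σ-normal form). -/
def EqSNF (t u : Tm) : Prop :=
  ∃ v : Tm, Relation.ReflTransGen SStep t v ∧
    Relation.ReflTransGen SStep u v ∧ SNormT v

mutual
/-- Potential redexability of terms: `prT t = true` iff `t` contains an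
application or a `λ` at some node. -/
def prT : Tm → Bool
  | .one => false
  | .app _ _ => true
  | .lam _ => true
  | .sub t s => prT t || prS s

/-- Potential redexability of substitutions. -/
def prS : Sb → Bool
  | .id => false
  | .shift => false
  | .cons t s => prT t || prS s
  | .comp s s' => prS s || prS s'
end

mutual
/-- The relation `≼` on terms. -/
inductive PrecT : Tm → Tm → Prop
  | idx (n m : ℕ) : PrecT (idx n) (idx m)
  | app {t t' u u' : Tm} : PrecT t t' → PrecT u u' → PrecT (.app t u) (.app t' u')
  | lam {t t' : Tm} : PrecT t t' → PrecT (.lam t) (.lam t')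
  | sub_r {t t' : Tm} {s : Sb} :
      PrecT t t' → prS s = false → PrecT t (.sub t' s)
  | sub {t t' : Tm} {s s' : Sb} :
      PrecT t t' → PrecS s s' → PrecT (.sub t s) (.sub t' s')

/-- The relation `≼` on substitutions. -/
inductive PrecS : Sb → Sb → Prop
  | shift : PrecS .shift .shift
  | id : PrecS .id .id
  | id_r {s : Sb} : prS s = false → PrecS .id s
  | cons {t t' : Tm} {s s' : Sb} :
      PrecT t t' → PrecS s s' → PrecS (.cons t s) (.cons t' s')
  | comp_r1 {s s' s1 : Sb} :
      PrecS s s' → prS s1 = false → PrecS s (.comp s' s1)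
  | comp_r2 {s s' s1 : Sb} :
      PrecS s s' → prS s1 = false → PrecS s (.comp s1 s')
  | comp {s1 s1' s2 s2' : Sb} :
      PrecS s1 s1' → PrecS s2 s2' → PrecS (.comp s1 s2) (.comp s1' s2')
end

/-- The relation `⋖` : `u ⋖ t` iff `u ≼ t` and `σ(u) = σ(t)`. -/
def Lessdot (u t : Tm) : Prop := PrecT u t ∧ EqSNF u t

/-- `⇑(s) = 1·(s∘↑)`. -/
def liftS (s : Sb) : Sb := .cons .one (.comp s .shift)

mutual
/-- Terms containing no `↑` (outside of de Bruijn indices, which are treated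
as atomic constants). -/
inductive NoShiftT : Tm → Prop
  | idx (n : ℕ) : NoShiftT (idx n)
  | app {t u : Tm} : NoShiftT t → NoShiftT u → NoShiftT (.app t u)
  | lam {t : Tm} : NoShiftT t → NoShiftT (.lam t)
  | sub {t : Tm} {s : Sb} : NoShiftT t → NoShiftS s → NoShiftT (.sub t s)

/-- Substitutions containing no `↑`. -/
inductive NoShiftS : Sb → Prop
  | id : NoShiftS .id
  | cons {t : Tm} {s : Sb} : NoShiftT t → NoShiftS s → NoShiftS (.cons t s)
  | comp {s s' : Sb} : NoShiftS s → NoShiftS s' → NoShiftS (.comp s s')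
end

open Relation

/-- λ-terms whose variables carry de Bruijn levels in `ℤ`; negative levels are free variables. -/
inductive LevelTm : Type
  | var : ℤ → LevelTm
  | app : LevelTm → LevelTm → LevelTm
  | lam : LevelTm → LevelTm

/-- Semantic values: a λ-term for each number of enclosing binders. -/
abbrev Value : Type := ℤ → LevelTm

/-- Extension of an environment with a value for index `1`. -/
def extend (d : Value) (ρ : ℕ → Value) : ℕ → Value
  | 0 => d
  | n + 1 => ρ n

mutual
/-- The value of a term in an environment. -/
def evalT : Tm → (ℕ → Value) → Value
  | .one, ρ => ρ 0
  | .app t u, ρ => fun k => .app (evalT t ρ k) (evalT u ρ k)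
  | .lam t, ρ => fun k => .lam (evalT t (extend (fun _ => .var k) ρ) (k + 1))
  | .sub t s, ρ => evalT t (evalS s ρ)

/-- The environment transformer denoted by a substitution. -/
def evalS : Sb → (ℕ → Value) → (ℕ → Value)
  | .id, ρ => ρ
  | .shift, ρ => fun n => ρ (n + 1)
  | .cons t s, ρ => extend (evalT t ρ) (evalS s ρ)
  | .comp s s', ρ => evalS s (evalS s' ρ)
end

mutual
theorem SStep.evalT_eq {t u : Tm} : SStep t u → ∀ ρ, evalT t ρ = evalT u ρ
  | .app_s, _ => by simp [evalT]
  | .lam_s, _ => by simp [evalT, evalS, extend]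
  | .varid, _ => by simp [evalT, evalS]
  | .varcons, _ => by simp [evalT, evalS, extend]
  | .clos, _ => by simp [evalT, evalS]
  | .appl h, ρ => by simp [evalT, h.evalT_eq ρ]
  | .appr h, ρ => by simp [evalT, h.evalT_eq ρ]
  | .lam h, ρ => by simp [evalT, h.evalT_eq]
  | .subt h, ρ => by simp [evalT, h.evalT_eq]
  | .subs h, ρ => by simp [evalT, h.evalS_eq ρ]

theorem SStepS.evalS_eq {s s' : Sb} : SStepS s s' → ∀ ρ, evalS s ρ = evalS s' ρ
  | .idl, _ => by simp [evalS]
  | .shiftid, _ => by simp [evalS]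
  | .shiftcons, _ => by simp [evalS, extend]
  | .mapr, _ => by simp [evalS, evalT]
  | .assoc, _ => by simp [evalS]
  | .consl h, ρ => by simp [evalS, h.evalT_eq ρ]
  | .consr h, ρ => by simp [evalS, h.evalS_eq ρ]
  | .compl h, ρ => by simp [evalS, h.evalS_eq]
  | .compr h, ρ => by simp [evalS, h.evalS_eq ρ]
end

theorem evalT_eq_of_reduces {t u : Tm} (h : ReflTransGen SStep t u) (ρ : ℕ → Value) :
    evalT t ρ = evalT u ρ := by
  induction h with
  | refl => rfl
  | tail _ h ih => exact ih.trans (h.evalT_eq ρ)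

/-- The normal form of `↑ ∘ ⋯ ∘ ↑` (`n` times), which is `id` for `n = 0`. -/
def shiftPow : ℕ → Sb
  | 0 => .id
  | 1 => .shift
  | n + 2 => .comp .shift (shiftPow (n + 1))

/-- The normal form of the index `n + 1`. -/
def varTm : ℕ → Tm
  | 0 => .one
  | n + 1 => .sub .one (shiftPow (n + 1))

/-- Terms that are indices in normal form. -/
def IsVar (t : Tm) : Prop := ∃ n, t = varTm n

/-- Syntactic description of σ-normal terms. -/
inductive NfT : Tm → Prop
  | var (n : ℕ) : NfT (varTm n)
  | app {t u : Tm} : NfT t → NfT u → NfT (.app t u)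
  | lam {t : Tm} : NfT t → NfT (.lam t)

/-- Substitutions `t₁ · ⋯ · tₘ · ↑ⁿ` whose components satisfy `P`. -/
inductive NfS (P : Tm → Prop) : Sb → Prop
  | shiftPow (n : ℕ) : NfS P (shiftPow n)
  | cons {t : Tm} {s : Sb} : P t → NfS P s → NfS P (.cons t s)

theorem sNormS_shiftPow : ∀ n, SNormS (shiftPow n)
  | 0 => by rintro _ ⟨⟩
  | 1 => by rintro _ ⟨⟩
  | 2 => by
    intro _ h
    cases h with
    | compl h => cases h
    | compr h => cases h
  | n + 3 => by
    intro _ h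
    cases h with
    | compl h => cases h
    | compr h => exact sNormS_shiftPow (n + 2) _ h

theorem sNormT_varTm : ∀ n, SNormT (varTm n)
  | 0 => by rintro _ ⟨⟩
  | 1 => by
    intro _ h
    cases h with
    | subt h => cases h
    | subs h => cases h
  | n + 2 => by
    intro _ h
    cases h with
    | subt h => cases h
    | subs h => exact sNormS_shiftPow (n + 2) _ h

theorem NfT.sNormT {t : Tm} (h : NfT t) : SNormT t := by
  induction h with
  | var n => exact sNormT_varTm n
  | app _ _ iht ihu =>
    intro _ h
    cases h with
    | appl h => exact iht _ h
    | appr h => exact ihu _ h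
  | lam _ ih =>
    intro _ h
    cases h with
    | lam h => exact ih _ h

theorem reduces_app {t t' u u' : Tm} (ht : ReflTransGen SStep t t')
    (hu : ReflTransGen SStep u u') : ReflTransGen SStep (.app t u) (.app t' u') :=
  (ht.lift (Tm.app · u) fun _ _ => .appl).trans (hu.lift (Tm.app t') fun _ _ => .appr)

theorem reduces_lam {t t' : Tm} (ht : ReflTransGen SStep t t') :
    ReflTransGen SStep (.lam t) (.lam t') :=
  ht.lift Tm.lam fun _ _ => .lam

theorem reduces_sub {t t' : Tm} {s s' : Sb} (ht : ReflTransGen SStep t t')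
    (hs : ReflTransGen SStepS s s') : ReflTransGen SStep (.sub t s) (.sub t' s') :=
  (ht.lift (Tm.sub · s) fun _ _ => .subt).trans (hs.lift (Tm.sub t') fun _ _ => .subs)

theorem reduces_cons {t t' : Tm} {s s' : Sb} (ht : ReflTransGen SStep t t')
    (hs : ReflTransGen SStepS s s') : ReflTransGen SStepS (.cons t s) (.cons t' s') :=
  (ht.lift (Sb.cons · s) fun _ _ => .consl).trans (hs.lift (Sb.cons t') fun _ _ => .consr)

theorem reduces_comp {s₁ s₁' s₂ s₂' : Sb} (h₁ : ReflTransGen SStepS s₁ s₁')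
    (h₂ : ReflTransGen SStepS s₂ s₂') :
    ReflTransGen SStepS (.comp s₁ s₂) (.comp s₁' s₂') :=
  (h₁.lift (Sb.comp · s₂) fun _ _ => .compl).trans (h₂.lift (Sb.comp s₁') fun _ _ => .compr)

section Normalization

variable {P : Tm → Prop}

theorem exists_shift_comp {s : Sb} (hs : NfS P s) :
    ∃ v, ReflTransGen SStepS (.comp .shift s) v ∧ NfS P v := by
  cases hs with
  | shiftPow n =>
    cases n with
    | zero => exact ⟨_, .single .shiftid, .shiftPow 1⟩
    | succ n => exact ⟨_, .refl, .shiftPow (n + 2)⟩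
  | cons _ hs => exact ⟨_, .single .shiftcons, hs⟩

theorem exists_shiftPow_comp {s : Sb} (hs : NfS P s) :
    ∀ n, ∃ v, ReflTransGen SStepS (.comp (shiftPow n) s) v ∧ NfS P v
  | 0 => ⟨s, .single .idl, hs⟩
  | 1 => exists_shift_comp hs
  | n + 2 => by
    obtain ⟨v, hv, hvn⟩ := exists_shiftPow_comp hs (n + 1)
    obtain ⟨w, hw, hwn⟩ := exists_shift_comp hvn
    exact ⟨w, .head .assoc ((reduces_comp .refl hv).trans hw), hwn⟩

theorem exists_one_sub {Q : Tm → Prop} (hQ : ∀ t, IsVar t → Q t) (hPQ : ∀ t, P t → Q t)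
    {s : Sb} (hs : NfS P s) : ∃ v, ReflTransGen SStep (.sub .one s) v ∧ Q v := by
  cases hs with
  | shiftPow n =>
    cases n with
    | zero => exact ⟨_, .single .varid, hQ _ ⟨0, rfl⟩⟩
    | succ n => exact ⟨_, .refl, hQ _ ⟨n + 1, rfl⟩⟩
  | cons ht _ => exact ⟨_, .single .varcons, hPQ _ ht⟩

theorem exists_varTm_sub {Q : Tm → Prop} (hQ : ∀ t, IsVar t → Q t) (hPQ : ∀ t, P t → Q t)
    {s : Sb} (hs : NfS P s) (n : ℕ) : ∃ v, ReflTransGen SStep (.sub (varTm n) s) v ∧ Q v := by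
  cases n with
  | zero => exact exists_one_sub hQ hPQ hs
  | succ n =>
    obtain ⟨v, hv, hvn⟩ := exists_shiftPow_comp hs (n + 1)
    obtain ⟨w, hw, hwn⟩ := exists_one_sub hQ hPQ hvn
    exact ⟨w, .head .clos ((reduces_sub .refl hv).trans hw), hwn⟩

theorem exists_comp {Q : Tm → Prop} {s' : Sb} (hs' : NfS Q s')
    (hP : ∀ t, P t → ∃ v, ReflTransGen SStep (.sub t s') v ∧ Q v) {s : Sb} (hs : NfS P s) :
    ∃ v, ReflTransGen SStepS (.comp s s') v ∧ NfS Q v := by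
  induction hs with
  | shiftPow n => exact exists_shiftPow_comp hs' n
  | cons ht _ ih =>
    obtain ⟨v, hv, hvn⟩ := hP _ ht
    obtain ⟨w, hw, hwn⟩ := ih
    exact ⟨_, .head .mapr (reduces_cons hv hw), .cons hvn hwn⟩

theorem exists_sub_of_shift (hone : P .one) (hPN : ∀ t, P t → NfT t)
    (hshift : ∀ t, P t → ∃ v, ReflTransGen SStep (.sub t .shift) v ∧ P v) {t : Tm}
    (ht : NfT t) : ∀ {s : Sb}, NfS P s → ∃ v, ReflTransGen SStep (.sub t s) v ∧ NfT v := by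
  induction ht with
  | var n =>
    intro s hs
    exact exists_varTm_sub (by rintro _ ⟨n, rfl⟩; exact .var n) hPN hs n
  | app _ _ iht ihu =>
    intro s hs
    obtain ⟨v, hv, hvn⟩ := iht hs
    obtain ⟨w, hw, hwn⟩ := ihu hs
    exact ⟨_, .head .app_s (reduces_app hv hw), .app hvn hwn⟩
  | lam _ ih =>
    intro s hs
    obtain ⟨v, hv, hvn⟩ := exists_comp (.shiftPow 1) hshift hs
    obtain ⟨w, hw, hwn⟩ := ih (.cons hone hvn)
    exact ⟨_, .head .lam_s (reduces_lam
      ((reduces_sub .refl (reduces_cons .refl hv)).trans hw)), .lam hwn⟩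

end Normalization

theorem NfT.exists_shift {t : Tm} (ht : NfT t) :
    ∃ v, ReflTransGen SStep (.sub t .shift) v ∧ NfT v := by
  refine exists_sub_of_shift (P := IsVar) ⟨0, rfl⟩ ?_ ?_ ht (.shiftPow 1)
  · rintro _ ⟨n, rfl⟩
    exact .var n
  · rintro _ ⟨n, rfl⟩
    exact exists_varTm_sub (fun _ => id) (fun _ => id) (.shiftPow 1) n

theorem NfT.exists_sub {t : Tm} (ht : NfT t) {s : Sb} (hs : NfS NfT s) :
    ∃ v, ReflTransGen SStep (.sub t s) v ∧ NfT v :=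
  exists_sub_of_shift (.var 0) (fun _ => id) (fun _ => NfT.exists_shift) ht hs

mutual
/-- Every term has a σ-normal form. -/
theorem exists_nfT : ∀ t : Tm, ∃ v, ReflTransGen SStep t v ∧ NfT v
  | .one => ⟨_, .refl, .var 0⟩
  | .app t u => by
    obtain ⟨v, hv, hvn⟩ := exists_nfT t
    obtain ⟨w, hw, hwn⟩ := exists_nfT u
    exact ⟨_, reduces_app hv hw, .app hvn hwn⟩
  | .lam t => by
    obtain ⟨v, hv, hvn⟩ := exists_nfT t
    exact ⟨_, reduces_lam hv, .lam hvn⟩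
  | .sub t s => by
    obtain ⟨v, hv, hvn⟩ := exists_nfT t
    obtain ⟨w, hw, hwn⟩ := exists_nfS s
    obtain ⟨x, hx, hxn⟩ := hvn.exists_sub hwn
    exact ⟨x, (reduces_sub hv hw).trans hx, hxn⟩

/-- Every substitution has a σ-normal form. -/
theorem exists_nfS : ∀ s : Sb, ∃ v, ReflTransGen SStepS s v ∧ NfS NfT v
  | .id => ⟨_, .refl, .shiftPow 0⟩
  | .shift => ⟨_, .refl, .shiftPow 1⟩
  | .cons t s => by
    obtain ⟨v, hv, hvn⟩ := exists_nfT t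
    obtain ⟨w, hw, hwn⟩ := exists_nfS s
    exact ⟨_, reduces_cons hv hw, .cons hvn hwn⟩
  | .comp s s' => by
    obtain ⟨v, hv, hvn⟩ := exists_nfS s
    obtain ⟨w, hw, hwn⟩ := exists_nfS s'
    obtain ⟨x, hx, hxn⟩ := exists_comp hwn (fun _ ht => ht.exists_sub hwn) hvn
    exact ⟨x, (reduces_comp hv hw).trans hx, hxn⟩
end

theorem evalS_shiftPow (ρ : ℕ → Value) : ∀ n i, evalS (shiftPow n) ρ i = ρ (i + n)
  | 0, _ => rfl
  | 1, _ => rfl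
  | n + 2, i => by
    simp only [shiftPow, evalS, evalS_shiftPow ρ (n + 1)]
    congr 1
    omega

theorem evalT_varTm (ρ : ℕ → Value) (n : ℕ) : evalT (varTm n) ρ = ρ n := by
  cases n with
  | zero => rfl
  | succ n => simp [varTm, evalT, evalS_shiftPow]

/-- The environment sending each index to the corresponding level below `k` binders. -/
def levelEnv (k : ℤ) : ℕ → Value := fun i _ => .var (k - 1 - i)

theorem extend_levelEnv (k : ℤ) :
    extend (fun _ => .var k) (levelEnv k) = levelEnv (k + 1) := by
  funext i j
  cases i with
  | zero => simp [extend, levelEnv]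
  | succ i => simp only [extend, levelEnv]; push_cast; congr 1; ring

/-- Evaluation separates σ-normal terms. -/
theorem NfT.eq_of_evalT_eq {t : Tm} (ht : NfT t) : ∀ {t' : Tm}, NfT t' → ∀ k : ℤ,
    evalT t (levelEnv k) k = evalT t' (levelEnv k) k → t = t' := by
  induction ht with
  | var n =>
    intro t' ht' k h
    rw [evalT_varTm] at h
    cases ht' with
    | var m =>
      rw [evalT_varTm] at h
      simp only [levelEnv, LevelTm.var.injEq] at h
      have hnm : n = m := by omega
      rw [hnm]
    | app _ _ => simp [levelEnv, evalT] at h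
    | lam _ => simp [levelEnv, evalT] at h
  | app _ _ iht ihu =>
    intro t' ht' k h
    cases ht' with
    | var m => rw [evalT_varTm] at h; simp [levelEnv, evalT] at h
    | app ht' hu' =>
      simp only [evalT, LevelTm.app.injEq] at h
      rw [iht ht' k h.1, ihu hu' k h.2]
    | lam _ => simp [evalT] at h
  | lam _ ih =>
    intro t' ht' k h
    cases ht' with
    | var m => rw [evalT_varTm] at h; simp [levelEnv, evalT] at h
    | app _ _ => simp [evalT] at h
    | lam ht' =>
      simp only [evalT, LevelTm.lam.injEq, extend_levelEnv] at h
      rw [ih ht' (k + 1) h]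

/-- Terms with the same values have the same σ-normal form. -/
theorem eqSNF_of_evalT_eq {t u : Tm} (h : ∀ ρ, evalT t ρ = evalT u ρ) : EqSNF t u := by
  obtain ⟨v, hv, hvn⟩ := exists_nfT t
  obtain ⟨w, hw, hwn⟩ := exists_nfT u
  obtain rfl : v = w := hvn.eq_of_evalT_eq hwn 0 <| by
    rw [← evalT_eq_of_reduces hv, ← evalT_eq_of_reduces hw, h]
  exact ⟨v, hv, hw, hvn.sNormT⟩

theorem EqSNF.evalT_eq {t u : Tm} (h : EqSNF t u) (ρ : ℕ → Value) : evalT t ρ = evalT u ρ := by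
  obtain ⟨v, ht, hu, -⟩ := h
  rw [evalT_eq_of_reduces ht, evalT_eq_of_reduces hu]

/-- Equalization of σ-normal forms: for `t`, `t'`, `u`, `s`, `s'` in
σ-normal form, if `σ(t[1·(s∘↑)]) = σ(t'[1·(s'∘↑)])` then
`σ(t[u·s]) = σ(t'[u·s'])`. -/
theorem eq_snf_cons (t t' u : Tm) (s s' : Sb)
    (ht : SNormT t) (ht' : SNormT t') (hu : SNormT u)
    (hs : SNormS s) (hs' : SNormS s')
    (h : EqSNF (.sub t (.cons .one (.comp s .shift)))
               (.sub t' (.cons .one (.comp s' .shift)))) :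
    EqSNF (.sub t (.cons u s)) (.sub t' (.cons u s')) := by
  exact eqSNF_of_evalT_eq fun ρ => h.evalT_eq (extend (evalT u ρ) ρ)

end LambdaSigma
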